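/- Let 𝐃 = D+1, coordinates x^1,…,x^𝐃 on ℝ^𝐃, r_𝐃² := Σ_{I=1}^𝐃 (x^I)², and let X_{𝐃,Λ}^{I_1…I_Λ} := 𝒫_𝐃^Λ{}^{I_1…I_Λ}_{J_1…J_Λ} x^{J_1}⋯x^{J_Λ} be the degree-Λ harmonic polynomials in 𝐃 variables. For 0 ≤ l ≤ Λ define F̌^{i_1…i_l}_{𝐃,Λ} := 𝒫^l{}^{i_1…i_l}_{j_1…j_l}·X_{𝐃,Λ}^{j_1…j_l 𝐃…𝐃} (j-indices summed over 1,…,D; the remaining Λ−l indices set equal to 𝐃). Then: (a) F̌^{i_1…i_l}_{𝐃,Λ} = p̌_{Λ,l}·X_l^{i_1…i_l}, where p̌_{Λ,l} := Σ_{k=0}^{⌊(Λ−l)/2⌋} b_{Λ,l+2k}·(x^𝐃)^{Λ−l−2k}·r_𝐃^{2k} with b_{Λ,l} := 1 and b_{Λ,l+2k} := (−1)^k·(Λ−l)!·(2Λ−4−2k+𝐃)!! / [(Λ−l−2k)!·(2k)!!·(2Λ−4+𝐃)!!] for k ≥ 1; (b) L² F̌^{i_1…i_l}_{𝐃,Λ}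 = l(l+D−2)·F̌^{i_1…i_l}_{𝐃,Λ}, where L² is the D-dimensional square angular momentum; (c) iL_{h𝐃} F̌^{i_1…i_l}_{𝐃,Λ} = (Λ−l)·F̌^{h i_1…i_l}_{𝐃,Λ} − (l(Λ+l+D−2)/(D+2l−2))·𝒫^l{}^{i_1 i_2…i_l}_{h j_2…j_l}·F̌^{j_2…j_l}_{𝐃,Λ}, where L_{h𝐃} = i(x^𝐃∂_h − x^h∂_𝐃). -/

import Mathlib

open scoped BigOperators

noncomputable section
namespace Fuzzy

/-- Matrices acting on `ℂ^D ⊗ ℂ^D`, indexed by pairs. -/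
abbrev PairMat (D : ℕ) := Matrix (Fin D × Fin D) (Fin D × Fin D) ℂ

/-- The flip (permutation) operator `𝖯` on `ℂ^D ⊗ ℂ^D`: `𝖯^{hi}_{jk} = δ^h_k δ^i_j`. -/
def flipMat (D : ℕ) : PairMat D := fun p q => if p.1 = q.2 ∧ p.2 = q.1 then 1 else 0

/-- The trace projector `𝒫ᵗ`: `𝒫ᵗ{}^{hi}_{jk} = δ^{hi} δ_{jk} / D`. -/
def traceMat (D : ℕ) : PairMat D :=
  fun p q => (if p.1 = p.2 then 1 else 0) * (if q.1 = q.2 then 1 else 0) / (D : ℂ)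

/-- The symmetric projector `𝒫⁺ = (1 + 𝖯)/2`. -/
def symPlusMat (D : ℕ) : PairMat D := (2 : ℂ)⁻¹ • ((1 : PairMat D) + flipMat D)

/-- The antisymmetric projector `𝒫⁻ = (1 − 𝖯)/2`. -/
def symMinusMat (D : ℕ) : PairMat D := (2 : ℂ)⁻¹ • ((1 : PairMat D) - flipMat D)

/-- The trace-free symmetric projector `𝒫 = 𝒫⁺ − 𝒫ᵗ`. -/
def PsMat (D : ℕ) : PairMat D := symPlusMat D - traceMat D

/-- `𝒫′ = 𝒫⁻ + 𝒫ᵗ`. -/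
def PprimeMat (D : ℕ) : PairMat D := symMinusMat D + traceMat D

/-- Embedding of an operator on `ℂ^D ⊗ ℂ^D` acting on the tensor factors `n, n+1`
(0-based) of `(ℂ^D)^{⊗ l}`, and as the identity on the other factors. -/
def embAt (D l n : ℕ) (A : PairMat D) :
    Matrix (Fin l → Fin D) (Fin l → Fin D) ℂ := fun i j =>
  if h : n + 1 < l then
    A (i ⟨n, Nat.lt_of_succ_lt h⟩, i ⟨n + 1, h⟩) (j ⟨n, Nat.lt_of_succ_lt h⟩, j ⟨n + 1, h⟩) *
      ∏ m : Fin l, (if m.val = n ∨ m.val = n + 1 then 1 else if i m = j m then 1 else 0)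
  else 0

/-- Extension of an operator on `(ℂ^D)^{⊗ l}` to `(ℂ^D)^{⊗ (l+1)}`, acting as the
identity on the last tensor factor. -/
def extendLast (D l : ℕ) (A : Matrix (Fin l → Fin D) (Fin l → Fin D) ℂ) :
    Matrix (Fin (l + 1) → Fin D) (Fin (l + 1) → Fin D) ℂ := fun i j =>
  A (fun m => i m.castSucc) (fun m => j m.castSucc) *
    (if i (Fin.last l) = j (Fin.last l) then 1 else 0)

/-- Extension of an operator on `(ℂ^D)^{⊗ l}` to `(ℂ^D)^{⊗ (l+1)}`, acting as the
identity on the first tensor factor. -/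
def extendFirst (D l : ℕ) (A : Matrix (Fin l → Fin D) (Fin l → Fin D) ℂ) :
    Matrix (Fin (l + 1) → Fin D) (Fin (l + 1) → Fin D) ℂ := fun i j =>
  A (fun m => i m.succ) (fun m => j m.succ) * (if i 0 = j 0 then 1 else 0)

/-- The matrix `M(l+1) = (1/(l+1)) [1 + l·𝖯 − (2Dl/(D+2l−2))·𝒫ᵗ]`. -/
def MStep (D l : ℕ) : PairMat D :=
  ((l : ℂ) + 1)⁻¹ •
    ((1 : PairMat D) + (l : ℂ) • flipMat D -
      (2 * (D : ℂ) * (l : ℂ) / ((D : ℂ) + 2 * (l : ℂ) - 2)) • traceMat D)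

/-- The completely symmetric trace-free projector `𝒫^l` on `(ℂ^D)^{⊗ l}`, defined
recursively by `𝒫^1 = id`, `𝒫^{l+1} = 𝒫^l_{1…l} M(l+1)_{l(l+1)} 𝒫^l_{1…l}`. -/
def symProj (D : ℕ) : (l : ℕ) → Matrix (Fin l → Fin D) (Fin l → Fin D) ℂ
  | 0 => 1
  | 1 => 1
  | (l + 2) =>
      extendLast D (l + 1) (symProj D (l + 1)) * embAt D (l + 2) l (MStep D (l + 1)) *
        extendLast D (l + 1) (symProj D (l + 1))


open MvPolynomial

/-- Complex polynomials in `E` variables. -/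
abbrev Poly (E : ℕ) := MvPolynomial (Fin E) ℂ

/-- The Laplacian `Δ = Σ_i ∂_i ∂_i`. -/
def lap {E : ℕ} (φ : Poly E) : Poly E := ∑ i : Fin E, pderiv i (pderiv i φ)

/-- The angular momentum operator `L_{ij} = i (x^j ∂_i − x^i ∂_j)`. -/
def ang {E : ℕ} (i j : Fin E) (φ : Poly E) : Poly E :=
  Complex.I • (X j * pderiv i φ - X i * pderiv j φ)

/-- The square angular momentum `L² = (1/2) Σ_{i,j} L_{ij} L_{ij}`. -/
def lsq {E : ℕ} (φ : Poly E) : Poly E :=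
  (2 : ℂ)⁻¹ • ∑ i : Fin E, ∑ j : Fin E, ang i j (ang i j φ)

/-- The Euler (dilatation) operator `η = Σ_i x^i ∂_i`. -/
def eta {E : ℕ} (φ : Poly E) : Poly E := ∑ i : Fin E, X i * pderiv i φ

/-- `r² = Σ_i (x^i)²`. -/
def r2 (E : ℕ) : Poly E := ∑ i : Fin E, X i * X i

/-- The harmonic polynomials `X_l^{i_1…i_l} := 𝒫^l{}^{i_1…i_l}_{j_1…j_l} x^{j_1} ⋯ x^{j_l}`. -/
def harmX (E l : ℕ) (i : Fin l → Fin E) : Poly E :=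
  ∑ j : Fin l → Fin E, symProj E l i j • ∏ m : Fin l, X (j m)

end Fuzzy

namespace Fuzzy

open MvPolynomial

/-- The coefficients `b_{Λ,l+2k}` (with `𝐃 = D+1`, so `2Λ−4+𝐃 = 2Λ+D−3`):
`b_{Λ,l} = 1` and, for `k ≥ 1`,
`b_{Λ,l+2k} = (−1)^k (Λ−l)! (2Λ−4−2k+𝐃)!! / [(Λ−l−2k)! (2k)!! (2Λ−4+𝐃)!!]`. -/
def bcoef (D Λ l k : ℕ) : ℂ :=
  if k = 0 then 1
  else ((-1 : ℂ)) ^ k * ((Λ - l).factorial : ℂ) *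
      ((2 * Λ + D - 3 - 2 * k).doubleFactorial : ℂ) /
    (((Λ - l - 2 * k).factorial : ℂ) * ((2 * k).doubleFactorial : ℂ) *
      ((2 * Λ + D - 3).doubleFactorial : ℂ))

/-- The polynomial `p̌_{Λ,l} = Σ_k b_{Λ,l+2k} (x^𝐃)^{Λ−l−2k} (r_𝐃²)^k`. -/
def pCheck (D Λ l : ℕ) : Poly (D + 1) :=
  ∑ k ∈ Finset.range ((Λ - l) / 2 + 1),
    bcoef D Λ l k • ((X (Fin.last D) : Poly (D + 1)) ^ (Λ - l - 2 * k) * (r2 (D + 1)) ^ k)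

/-- The index tuple `(j_1, …, j_l, 𝐃, …, 𝐃)` of length `Λ`. -/
def extIdx (D l Λ : ℕ) (j : Fin l → Fin D) : Fin Λ → Fin (D + 1) := fun m =>
  if h : m.val < l then Fin.castSucc (j ⟨m.val, h⟩) else Fin.last D

/-- `F̌^{i_1…i_l}_{𝐃,Λ} := 𝒫^l{}^{i…}_{j…} X_{𝐃,Λ}^{j_1…j_l 𝐃…𝐃}`. -/
def Fcheck (D Λ l : ℕ) (i : Fin l → Fin D) : Poly (D + 1) :=
  ∑ j : Fin l → Fin D, symProj D l i j • harmX (D + 1) Λ (extIdx D l Λ j)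

/-- The `D`-dimensional square angular momentum `L² = (1/2)Σ_{i,j≤D} L_{ij}L_{ij}`
acting on polynomials in `D+1` variables. -/
def lsqLow (D : ℕ) (φ : Poly (D + 1)) : Poly (D + 1) :=
  (2 : ℂ)⁻¹ • ∑ i : Fin D, ∑ j : Fin D,
    ang (Fin.castSucc i) (Fin.castSucc j) (ang (Fin.castSucc i) (Fin.castSucc j) φ)


/-! ### Polynomial calculus -/

/-- The Laplacian as a linear map. -/
def lapL (E : ℕ) : Poly E →ₗ[ℂ] Poly E :=
  ∑ i : Fin E, (pderiv i).toLinearMap ∘ₗ (pderiv i).toLinearMap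

lemma lapL_apply {E : ℕ} (φ : Poly E) : lapL E φ = lap φ := by
  simp [lapL, lap]

/-- Harmonic homogeneous polynomials of degree `d`. -/
def HS (E d : ℕ) : Submodule ℂ (Poly E) :=
  homogeneousSubmodule (Fin E) ℂ d ⊓ LinearMap.ker (lapL E)

lemma mem_HS {E d : ℕ} {φ : Poly E} : φ ∈ HS E d ↔ φ.IsHomogeneous d ∧ lap φ = 0 := by
  simp [HS, lapL_apply, Submodule.mem_inf, mem_homogeneousSubmodule]

lemma C2 (E : ℕ) : (C 2 : Poly E) = 2 := map_ofNat C 2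

lemma pderiv_comm {E : ℕ} (i j : Fin E) (φ : Poly E) :
    pderiv i (pderiv j φ) = pderiv j (pderiv i φ) := by
  have : ⁅(pderiv i : Derivation ℂ (Poly E) (Poly E)),
      (pderiv j : Derivation ℂ (Poly E) (Poly E))⁆ = 0 := by
    apply MvPolynomial.derivation_ext
    intro k
    simp only [Derivation.commutator_apply, pderiv_X, Derivation.coe_zero, Pi.zero_apply]
    by_cases h1 : j = k <;> by_cases h2 : i = k <;> simp [h1, h2]
  have h := congrArg (fun d => d φ) this
  simpa [Derivation.commutator_apply, sub_eq_zero] using h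

lemma lap_mul {E : ℕ} (φ ψ : Poly E) :
    lap (φ * ψ) = lap φ * ψ + 2 * ∑ i, pderiv i φ * pderiv i ψ + φ * lap ψ := by
  simp only [lap, pderiv_mul, map_add, Finset.sum_mul, Finset.mul_sum, ← Finset.sum_add_distrib]
  exact Finset.sum_congr rfl fun i _ => by ring

lemma pderiv_r2 {E : ℕ} (i : Fin E) : pderiv i (r2 E) = 2 * X i := by
  simp [r2, pderiv_X, Pi.single_apply, Finset.sum_add_distrib, two_mul]

lemma lap_r2 (E : ℕ) : lap (r2 E) = 2 * (E : Poly E) := by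
  have : ∀ i : Fin E, pderiv i ((2 : Poly E) * X i) = 2 := by
    intro i
    rw [← C2, pderiv_C_mul]; simp
  simp only [lap, pderiv_r2, this]
  simp [mul_comm]

lemma euler {E d : ℕ} {φ : Poly E} (h : φ.IsHomogeneous d) :
    ∑ i, X i * pderiv i φ = (d : Poly E) * φ := by
  rw [h.sum_X_mul_pderiv, nsmul_eq_mul]

lemma lap_r2_mul {E d : ℕ} {φ : Poly E} (h : φ.IsHomogeneous d) :
    lap (r2 E * φ) = (2 * E + 4 * d : Poly E) * φ + r2 E * lap φ := by
  rw [lap_mul, lap_r2]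
  have : ∑ i, pderiv i (r2 E) * pderiv i φ = 2 * (d * φ) := by
    rw [← euler h, Finset.mul_sum]
    exact Finset.sum_congr rfl fun i _ => by rw [pderiv_r2]; ring
  rw [this]; ring

lemma r2_hom (E : ℕ) : (r2 E).IsHomogeneous 2 :=
  IsHomogeneous.sum _ _ _ fun i _ => (isHomogeneous_X ℂ i).mul (isHomogeneous_X ℂ i)

lemma r2_ne {E : ℕ} (hE : 1 ≤ E) : r2 E ≠ 0 := by
  intro h
  have := lap_r2 E
  rw [h] at this
  simp [lap] at this
  omega

lemma lap_r2_pow_mul {E d : ℕ} {φ : Poly E} (h : φ.IsHomogeneous d) (k : ℕ) :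
    lap (r2 E ^ (k + 1) * φ) =
      (2 * (k + 1) * (2 * k + E + 2 * d) : Poly E) * (r2 E ^ k * φ) + r2 E ^ (k + 1) * lap φ := by
  induction k with
  | zero => rw [zero_add, pow_one, lap_r2_mul h]; push_cast; ring
  | succ k ih =>
    have h2 : (r2 E ^ (k + 1) * φ).IsHomogeneous (2 * (k + 1) + d) := ((r2_hom E).pow _).mul h
    rw [pow_succ' _ (k + 1), mul_assoc, lap_r2_mul h2, ih]
    push_cast
    ring

lemma lap_X_mul {E : ℕ} (h : Fin E) (φ : Poly E) :
    lap (X h * φ) = 2 * pderiv h φ + X h * lap φ := by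
  rw [lap_mul]
  have h1 : lap (X h : Poly E) = 0 := by
    simp only [lap]
    refine Finset.sum_eq_zero fun i _ => ?_
    by_cases hi : i = h <;> simp [pderiv_X, hi]
  rw [h1]
  simp [pderiv_X, Pi.single_apply]

lemma lap_pderiv {E : ℕ} (h : Fin E) (φ : Poly E) : lap (pderiv h φ) = pderiv h (lap φ) := by
  simp only [lap, map_sum]
  exact Finset.sum_congr rfl fun i _ => by rw [pderiv_comm i h φ, pderiv_comm i h]

lemma lap_smul {E : ℕ} (c : ℂ) (φ : Poly E) : lap (c • φ) = c • lap φ := by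
  rw [← lapL_apply, map_smul, lapL_apply]

lemma lap_sub {E : ℕ} (φ ψ : Poly E) : lap (φ - ψ) = lap φ - lap ψ := by
  simp_rw [← lapL_apply, map_sub]

/-! ### Divisibility by `r²` and harmonic uniqueness -/

lemma homComp_mul {E a : ℕ} {p : Poly E} (hp : p.IsHomogeneous a) (q : Poly E) (d : ℕ) :
    homogeneousComponent d (p * q) =
      if a ≤ d then p * homogeneousComponent (d - a) q else 0 := by
  conv_lhs => rw [← sum_homogeneousComponent q, Finset.mul_sum, map_sum]
  have : ∀ n, homogeneousComponent d (p * homogeneousComponent n q) =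
      if a + n = d then p * homogeneousComponent n q else 0 := by
    intro n
    have h := hp.mul (homogeneousComponent_isHomogeneous n q)
    rw [homogeneousComponent_of_mem ((mem_homogeneousSubmodule _ _).2 h)]
    simp [eq_comm]
  simp_rw [this]
  split_ifs with had
  · obtain ⟨e, rfl⟩ := Nat.exists_eq_add_of_le had
    simp only [Nat.add_left_cancel_iff, Nat.add_sub_cancel_left, Finset.sum_ite_eq',
      Finset.mem_range]
    split_ifs with h
    · rfl
    · rw [homogeneousComponent_eq_zero _ _ (by omega), mul_zero]
  · exact Finset.sum_eq_zero fun n _ => if_neg (by omega)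

lemma dvd_hom {E d : ℕ} {φ : Poly E} (h : φ.IsHomogeneous d) (hd : r2 E ∣ φ) (h0 : φ ≠ 0) :
    ∃ e q, d = e + 2 ∧ IsHomogeneous q e ∧ φ = r2 E * q := by
  obtain ⟨q, hq⟩ := hd
  have h1 := homComp_mul (r2_hom E) q d
  rw [← hq, homogeneousComponent_of_mem ((mem_homogeneousSubmodule _ _).2 h), if_pos rfl] at h1
  split_ifs at h1 with h2
  · exact ⟨d - 2, _, by omega, homogeneousComponent_isHomogeneous _ _, h1⟩
  · exact absurd h1 h0

lemma HS_unique0 {E d : ℕ} (hE : 1 ≤ E) {φ : Poly E} (h : φ ∈ HS E d) (hd : r2 E ∣ φ) :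
    φ = 0 := by
  by_contra h0
  obtain ⟨hh, hl⟩ := mem_HS.1 h
  have key : ∀ k : ℕ, ∃ e q, d = e + 2 * (k + 1) ∧ IsHomogeneous q e ∧ φ = r2 E ^ (k + 1) * q := by
    intro k
    induction k with
    | zero => simpa using dvd_hom hh hd h0
    | succ k ih =>
      obtain ⟨e, q, he, hq, rfl⟩ := ih
      rw [lap_r2_pow_mul hq] at hl
      have hc : (2 * (k + 1) * (2 * k + E + 2 * e) : Poly E) =
          C ((2 * (k + 1) * (2 * k + E + 2 * e) : ℕ) : ℂ) := by simp [C2]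
      have hcn : ((2 * (k + 1) * (2 * k + E + 2 * e) : ℕ) : ℂ) ≠ 0 := by
        have : 0 < 2 * (k + 1) * (2 * k + E + 2 * e) := by positivity
        exact_mod_cast this.ne'
      rw [hc] at hl
      generalize ((2 * (k + 1) * (2 * k + E + 2 * e) : ℕ) : ℂ) = c at hl hcn
      have h3 : r2 E ^ k * (C c * q + r2 E * lap q) = 0 := by
        rw [← hl]; ring
      have h4 := (mul_eq_zero.1 h3).resolve_left (pow_ne_zero _ (r2_ne hE))
      have h5 : q = r2 E * (- (C c⁻¹ * lap q)) := by
        have : C c⁻¹ * (C c * q + r2 E * lap q) = 0 := by rw [h4, mul_zero]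
        have h6 : (C c⁻¹ * C c : Poly E) = 1 := by rw [← C_mul, inv_mul_cancel₀ hcn, C_1]
        linear_combination this - q * h6
      have hq0 : q ≠ 0 := by rintro rfl; simp at h0
      obtain ⟨e', q', he', hq', hqq⟩ := dvd_hom hq ⟨_, h5⟩ hq0
      refine ⟨e', q', by omega, hq', ?_⟩
      rw [hqq]; ring
  obtain ⟨e, q, he, -, -⟩ := key d
  omega

lemma HS_unique {E d : ℕ} (hE : 1 ≤ E) {φ ψ : Poly E} (h : φ ∈ HS E d) (h' : ψ ∈ HS E d)
    (hd : r2 E ∣ φ - ψ) : φ = ψ :=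
  sub_eq_zero.1 (HS_unique0 hE (Submodule.sub_mem _ h h') hd)

lemma HS_pderiv {E d : ℕ} {φ : Poly E} (h : φ ∈ HS E (d + 1)) (k : Fin E) :
    pderiv k φ ∈ HS E d := by
  obtain ⟨h1, h2⟩ := mem_HS.1 h
  exact mem_HS.2 ⟨by simpa using h1.pderiv (i := k), by rw [lap_pderiv, h2, map_zero]⟩

lemma HS_step {E d : ℕ} (hE : 2 ≤ E) {φ : Poly E} (h : φ ∈ HS E d) (k : Fin E) :
    X k * φ - ((E : ℂ) + 2 * d - 2)⁻¹ • (r2 E * pderiv k φ) ∈ HS E (d + 1) := by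
  obtain ⟨h1, h2⟩ := mem_HS.1 h
  cases d with
  | zero =>
    have h3 : pderiv k φ = 0 := by
      rw [← totalDegree_zero_iff_isHomogeneous, totalDegree_eq_zero_iff_eq_C] at h1
      rw [h1, pderiv_C]
    rw [h3]
    simp only [mul_zero, smul_zero, sub_zero]
    refine mem_HS.2 ⟨?_, ?_⟩
    · rw [add_comm]; exact (isHomogeneous_X ℂ k).mul h1
    · rw [lap_X_mul, h3, h2]; simp
  | succ d =>
    obtain ⟨h3, h4⟩ := mem_HS.1 (HS_pderiv h k)
    refine mem_HS.2 ⟨?_, ?_⟩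
    · refine IsHomogeneous.sub ?_ ?_
      · rw [add_comm]; exact (isHomogeneous_X ℂ k).mul h1
      · rw [smul_eq_C_mul]
        refine IsHomogeneous.C_mul ?_ _
        have := (r2_hom E).mul h3
        rwa [show 2 + d = d + 1 + 1 by omega] at this
    · rw [lap_sub, lap_smul, lap_X_mul, lap_r2_mul h3, h2, h4]
      have hc : (2 * E + 4 * d : Poly E) = C (2 * ((E : ℂ) + 2 * (d + 1 : ℕ) - 2)) := by
        simp [C2]; ring
      have hn : ((E : ℂ) + 2 * (d + 1 : ℕ) - 2) ≠ 0 := by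
        have : ((E : ℂ) + 2 * (d + 1 : ℕ) - 2) = ((E + 2 * d : ℕ) : ℂ) := by push_cast; ring
        rw [this]
        exact_mod_cast (by omega : E + 2 * d ≠ 0)
      rw [hc, mul_zero, mul_zero, add_zero, add_zero, ← smul_eq_C_mul, smul_smul,
        mul_left_comm, inv_mul_cancel₀ hn, mul_one, smul_eq_C_mul, C2, sub_self]


/-! ### The recursive harmonic polynomials and iterated derivatives -/

/-- Harmonic polynomials, defined recursively by the harmonic projection of `x^k φ`. -/
def HP (E : ℕ) : (l : ℕ) → (Fin l → Fin E) → Poly E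
  | 0, _ => 1
  | (l + 1), i => X (i (Fin.last l)) * HP E l (fun m => i m.castSucc) -
      ((E : ℂ) + 2 * l - 2)⁻¹ •
        (r2 E * pderiv (i (Fin.last l)) (HP E l (fun m => i m.castSucc)))

/-- The constant term of the iterated derivative `∂_{j_1} ⋯ ∂_{j_l} φ`. -/
def TT (E : ℕ) : (l : ℕ) → (Fin l → Fin E) → Poly E →ₗ[ℂ] ℂ
  | 0, _ => (MvPolynomial.aeval (fun _ => (0 : ℂ)) : Poly E →ₐ[ℂ] ℂ).toLinearMap
  | (l + 1), j => TT E l (fun m => j m.castSucc) ∘ₗ (pderiv (j (Fin.last l))).toLinearMap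

lemma TT_succ {E l : ℕ} (j : Fin (l + 1) → Fin E) (φ : Poly E) :
    TT E (l + 1) j φ = TT E l (fun m => j m.castSucc) (pderiv (j (Fin.last l)) φ) := rfl

/-- Appending an index. -/
def sn {E l : ℕ} (a : Fin l → Fin E) (k : Fin E) : Fin (l + 1) → Fin E :=
  Fin.snoc (α := fun _ => Fin E) a k

@[simp] lemma sn_last {E l : ℕ} (a : Fin l → Fin E) (k : Fin E) : sn a k (Fin.last l) = k := by
  simp [sn]

@[simp] lemma sn_castSucc {E l : ℕ} (a : Fin l → Fin E) (k : Fin E) (m : Fin l) :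
    sn a k m.castSucc = a m := by
  simp [sn]

lemma sn_init {E l : ℕ} (i : Fin (l + 1) → Fin E) :
    sn (fun m => i m.castSucc) (i (Fin.last l)) = i := by
  funext m
  refine Fin.lastCases ?_ (fun m => ?_) m <;> simp

lemma sum_sn {E l : ℕ} {A : Type*} [AddCommMonoid A] (f : (Fin (l + 1) → Fin E) → A) :
    ∑ j, f j = ∑ k, ∑ a, f (sn a k) := by
  rw [← Fintype.sum_prod_type' (f := fun k a => f (sn a k))]
  exact ((Fin.snocEquiv (fun _ : Fin (l + 1) => Fin E)).sum_comp f).symm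

lemma TT_cons {E l : ℕ} (h : Fin E) (j : Fin l → Fin E) (φ : Poly E) :
    TT E (l + 1) (Fin.cons h j) φ = TT E l j (pderiv h φ) := by
  induction l generalizing φ with
  | zero => rfl
  | succ l ih =>
    have h1 : (fun m : Fin (l + 1) => (Fin.cons h j : Fin (l + 2) → Fin E) m.castSucc) =
        Fin.cons h (fun m => j m.castSucc) := by
      funext m
      refine Fin.cases ?_ (fun m => ?_) m
      · simp
      · rw [← Fin.succ_castSucc]; simp
    have h2 : (Fin.cons h j : Fin (l + 2) → Fin E) (Fin.last (l + 1)) = j (Fin.last l) := by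
      rw [← Fin.succ_last]; simp
    rw [TT_succ, h1, h2, ih, pderiv_comm]
    rfl

lemma taylor {E l : ℕ} {φ : Poly E} (h : φ.IsHomogeneous l) :
    ∑ j : Fin l → Fin E, TT E l j φ • ∏ m, X (j m) = (l.factorial : ℂ) • φ := by
  induction l generalizing φ with
  | zero =>
    rw [← totalDegree_zero_iff_isHomogeneous, totalDegree_eq_zero_iff_eq_C] at h
    rw [h]
    simp [TT, smul_eq_C_mul]
  | succ l ih =>
    rw [sum_sn]
    have : ∀ k : Fin E, ∑ a : Fin l → Fin E, TT E (l + 1) (sn a k) φ • ∏ m, X (sn a k m) =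
        (l.factorial : ℂ) • ((X k : Poly E) * pderiv k φ) := by
      intro k
      rw [← mul_smul_comm, ← ih (by simpa using h.pderiv (i := k)), Finset.mul_sum]
      refine Finset.sum_congr rfl fun a _ => ?_
      rw [TT_succ, Fin.prod_univ_castSucc]
      simp only [sn_last, sn_castSucc, mul_smul_comm]
      rw [mul_comm]
    simp_rw [this]
    rw [← Finset.smul_sum, euler h, Nat.factorial_succ, mul_comm (l + 1), Nat.cast_mul, mul_smul]
    congr 1
    simp [smul_eq_C_mul]

lemma HP_succ {E l : ℕ} (a : Fin l → Fin E) (k : Fin E) :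
    HP E (l + 1) (sn a k) = X k * HP E l a -
      ((E : ℂ) + 2 * l - 2)⁻¹ • (r2 E * pderiv k (HP E l a)) := by
  simp [HP]

lemma HP_mem {E : ℕ} (hE : 2 ≤ E) (l : ℕ) (i : Fin l → Fin E) : HP E l i ∈ HS E l := by
  induction l with
  | zero => exact mem_HS.2 ⟨isHomogeneous_one _ _, by simp [HP, lap]⟩
  | succ l ih => exact HS_step hE (ih _) _

lemma HP_congr {E : ℕ} (l : ℕ) (i : Fin l → Fin E) : r2 E ∣ HP E l i - ∏ m, X (i m) := by
  induction l with
  | zero => simp [HP]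
  | succ l ih =>
    obtain ⟨q, hq⟩ := ih (fun m => i m.castSucc)
    rw [Fin.prod_univ_castSucc, HP]
    refine ⟨X (i (Fin.last l)) * q - ((E : ℂ) + 2 * l - 2)⁻¹ •
      pderiv (i (Fin.last l)) (HP E l (fun m => i m.castSucc)), ?_⟩
    simp only [smul_eq_C_mul]
    linear_combination X (i (Fin.last l)) * hq

lemma harm_expand {E l : ℕ} (hE : 2 ≤ E) {φ : Poly E} (h : φ ∈ HS E l) :
    ∑ a : Fin l → Fin E, TT E l a φ • HP E l a = (l.factorial : ℂ) • φ := by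
  refine HS_unique (by omega)
    (Submodule.sum_mem _ fun a _ => Submodule.smul_mem _ _ (HP_mem hE l a))
    (Submodule.smul_mem _ _ h) ?_
  rw [← taylor (mem_HS.1 h).1, ← Finset.sum_sub_distrib]
  refine Finset.dvd_sum fun a _ => ?_
  rw [← smul_sub, smul_eq_C_mul]
  exact Dvd.dvd.mul_left (HP_congr l a) _

/-! ### Identification of the projector -/

lemma embAt_sn {E l : ℕ} (A : PairMat E) (a a' : Fin l → Fin E) (b c h k : Fin E) :
    embAt E (l + 2) l A (sn (sn a b) h) (sn (sn a' c) k) =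
      if a = a' then A (b, h) (c, k) else 0 := by
  have e1 : ∀ hh : l < l + 2, (⟨l, hh⟩ : Fin (l + 2)) = (Fin.last l).castSucc := fun _ => rfl
  have e2 : ∀ hh : l + 1 < l + 2, (⟨l + 1, hh⟩ : Fin (l + 2)) = Fin.last (l + 1) := fun _ => rfl
  rw [embAt, dif_pos (by omega), Fin.prod_univ_castSucc, Fin.prod_univ_castSucc]
  simp only [e1, e2, sn_last, sn_castSucc, Fin.val_castSucc, Fin.val_last, true_or, or_true,
    if_true, mul_one]
  have : ∏ m : Fin l, (if (m : ℕ) = l ∨ (m : ℕ) = l + 1 then (1 : ℂ)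
      else if a m = a' m then 1 else 0) = if a = a' then 1 else 0 := by
    have h1 : ∀ m : Fin l, ¬ ((m : ℕ) = l ∨ (m : ℕ) = l + 1) := fun m => by omega
    simp only [h1, if_false]
    rw [Finset.prod_ite_zero]
    simp [funext_iff]
  rw [this]
  split_ifs <;> simp

lemma symProj_entry {E l : ℕ} (i j : Fin (l + 2) → Fin E) :
    symProj E (l + 2) i j = ∑ a : Fin l → Fin E, ∑ b : Fin E, ∑ c : Fin E,
      symProj E (l + 1) (fun m => i m.castSucc) (sn a b) *
        MStep E (l + 1) (b, i (Fin.last _)) (c, j (Fin.last _)) *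
        symProj E (l + 1) (sn a c) (fun m => j m.castSucc) := by
  rw [symProj, Matrix.mul_apply]
  simp only [Matrix.mul_apply]
  simp_rw [sum_sn (l := l + 1), sum_sn (l := l), embAt_sn, extendLast, sn_last, sn_castSucc]
  simp only [mul_ite, mul_zero, mul_one, ite_mul, zero_mul, Finset.sum_ite_eq',
    Finset.mem_univ, if_true, Finset.sum_mul]
  rw [Finset.sum_eq_single (j (Fin.last (l + 1))) (fun x _ hx => by simp [hx]) (by simp)]
  simp only [if_true]
  have key : ∀ (p : Fin E) (f : Fin E → Fin E → ℂ),
      (∑ x, ∑ y, if p = x then f x y else 0) = ∑ y, f p y := by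
    intro p f
    rw [Finset.sum_comm]; simp
  simp_rw [key]
  rw [Finset.sum_comm]
  exact Finset.sum_congr rfl fun a _ => Finset.sum_comm

lemma MStep_apply {E : ℕ} (hE : 2 ≤ E) (n : ℕ) (b h c k : Fin E) :
    MStep E n (b, h) (c, k) = ((n : ℂ) + 1)⁻¹ *
      ((if b = c then if h = k then 1 else 0 else 0) +
        (n : ℂ) * (if b = k then if h = c then 1 else 0 else 0) -
        (2 * n * ((E : ℂ) + 2 * n - 2)⁻¹) * (if b = h then if c = k then 1 else 0 else 0)) := by
  have hE' : (E : ℂ) ≠ 0 := by exact_mod_cast (by omega : E ≠ 0)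
  simp only [MStep, flipMat, traceMat, Matrix.smul_apply, Matrix.sub_apply, Matrix.add_apply,
    Matrix.one_apply, smul_eq_mul, Prod.mk.injEq, ite_and]
  congr 2
  split_ifs <;> field_simp <;> ring


/-- Entries of the projector, as a plain function. -/
def sP (E l : ℕ) (i j : Fin l → Fin E) : ℂ := symProj E l i j

lemma sP_entry {E l : ℕ} (i j : Fin (l + 2) → Fin E) :
    sP E (l + 2) i j = ∑ a : Fin l → Fin E, ∑ b : Fin E, ∑ c : Fin E,
      sP E (l + 1) (fun m => i m.castSucc) (sn a b) *
        MStep E (l + 1) (b, i (Fin.last _)) (c, j (Fin.last _)) *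
        sP E (l + 1) (sn a c) (fun m => j m.castSucc) := symProj_entry i j

lemma symProj_contract {E l : ℕ} (hE : 2 ≤ E)
    (S : ∀ i j, sP E (l + 1) i j = ((l + 1).factorial : ℂ)⁻¹ * TT E (l + 1) j (HP E (l + 1) i))
    (i : Fin (l + 1) → Fin E) (h : Fin E) :
    ∑ a : Fin l → Fin E, sP E (l + 1) i (sn a h) • HP E l a =
      ((l : ℂ) + 1)⁻¹ • pderiv h (HP E (l + 1) i) := by
  have h1 := harm_expand hE (HS_pderiv (HP_mem hE (l + 1) i) h)
  have h2 : ∀ a : Fin l → Fin E, sP E (l + 1) i (sn a h) =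
      ((l + 1).factorial : ℂ)⁻¹ * TT E l a (pderiv h (HP E (l + 1) i)) := by
    intro a
    rw [S, TT_succ]; simp
  simp_rw [h2, mul_smul]
  rw [← Finset.smul_sum, h1, smul_smul]
  congr 1
  have : (l.factorial : ℂ) ≠ 0 := by exact_mod_cast l.factorial_ne_zero
  have : (l : ℂ) + 1 ≠ 0 := by exact_mod_cast Nat.succ_ne_zero l
  rw [Nat.factorial_succ]; push_cast; field_simp

lemma symProj_contract' {E l : ℕ} (hE : 2 ≤ E)
    (S : ∀ i j, sP E (l + 1) i j = ((l + 1).factorial : ℂ)⁻¹ * TT E (l + 1) j (HP E (l + 1) i))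
    (i : Fin (l + 1) → Fin E) (h k : Fin E) :
    ∑ a : Fin l → Fin E, sP E (l + 1) i (sn a h) • HP E (l + 1) (sn a k) =
      ((l : ℂ) + 1)⁻¹ • (X k * pderiv h (HP E (l + 1) i) - ((E : ℂ) + 2 * l - 2)⁻¹ •
        (r2 E * pderiv k (pderiv h (HP E (l + 1) i)))) := by
  have h1 := symProj_contract hE S i h
  have h2 := congrArg (pderiv k) h1
  rw [map_sum, Derivation.map_smul] at h2
  simp_rw [Derivation.map_smul] at h2
  rw [smul_sub, smul_comm, ← mul_smul_comm, ← mul_smul_comm, ← h1, ← h2, Finset.mul_sum,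
    Finset.mul_sum, Finset.smul_sum, ← Finset.sum_sub_distrib]
  refine Finset.sum_congr rfl fun a _ => ?_
  rw [HP_succ, smul_sub, mul_smul_comm, mul_smul_comm, smul_comm]

lemma symProj_self {E l : ℕ} (hE : 2 ≤ E)
    (S : ∀ i j, sP E l i j = (l.factorial : ℂ)⁻¹ * TT E l j (HP E l i))
    (i : Fin l → Fin E) :
    ∑ u : Fin l → Fin E, sP E l i u • HP E l u = HP E l i := by
  simp_rw [S, mul_smul]
  rw [← Finset.smul_sum, harm_expand hE (HP_mem hE l i), smul_smul, inv_mul_cancel₀, one_smul]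
  exact_mod_cast l.factorial_ne_zero

lemma symProj_key {E l : ℕ} (hE : 2 ≤ E)
    (S : ∀ i j, sP E (l + 1) i j = ((l + 1).factorial : ℂ)⁻¹ * TT E (l + 1) j (HP E (l + 1) i))
    (i : Fin (l + 1) → Fin E) (h k : Fin E) :
    ∑ a : Fin l → Fin E, ∑ b : Fin E, ∑ c : Fin E,
      (sP E (l + 1) i (sn a b) * MStep E (l + 1) (b, h) (c, k)) • HP E (l + 1) (sn a c) =
      ((l : ℂ) + 2)⁻¹ • pderiv k (HP E (l + 2) (sn i h)) := by
  have e1 : ∀ a : Fin l → Fin E, ∑ b : Fin E, ∑ c : Fin E,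
      (sP E (l + 1) i (sn a b) * MStep E (l + 1) (b, h) (c, k)) • HP E (l + 1) (sn a c) =
      (((l + 1 : ℕ) : ℂ) + 1)⁻¹ • ((if h = k then (1 : ℂ) else 0) •
          ∑ b, sP E (l + 1) i (sn a b) • HP E (l + 1) (sn a b)
        + ((l + 1 : ℕ) : ℂ) • (sP E (l + 1) i (sn a k) • HP E (l + 1) (sn a h))
        - (2 * (l + 1 : ℕ) * ((E : ℂ) + 2 * (l + 1 : ℕ) - 2)⁻¹) • (sP E (l + 1) i (sn a h) • HP E (l + 1) (sn a k))) := by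
    intro a
    have : ∀ b c, (sP E (l + 1) i (sn a b) * MStep E (l + 1) (b, h) (c, k)) • HP E (l + 1) (sn a c) =
      (((l + 1 : ℕ) : ℂ) + 1)⁻¹ • (
        (if b = c then ((if h = k then (1 : ℂ) else 0) • sP E (l + 1) i (sn a b) • HP E (l + 1) (sn a c))
          else 0) +
        (if b = k then if h = c then (((l + 1 : ℕ) : ℂ) • sP E (l + 1) i (sn a b) • HP E (l + 1) (sn a c))
          else 0 else 0) -
        (if b = h then if c = k then
          ((2 * (l + 1 : ℕ) * ((E : ℂ) + 2 * (l + 1 : ℕ) - 2)⁻¹) • sP E (l + 1) i (sn a b) • HP E (l + 1) (sn a c))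
          else 0 else 0)) := by
      intro b c
      rw [MStep_apply hE]
      split_ifs <;> simp only [smul_smul, ← sub_smul, ← add_smul, smul_zero,
        add_zero, zero_add, sub_zero, zero_sub, ← neg_smul] <;> (try congr 1) <;> ring_nf <;> simp
    rw [Finset.sum_congr rfl fun b _ => Finset.sum_congr rfl fun c _ => this b c]
    simp only [← Finset.smul_sum, Finset.sum_sub_distrib, Finset.sum_add_distrib,
      Finset.sum_ite_eq, Finset.mem_univ, if_true]
    congr 3
    · simp [Finset.sum_ite_eq]
    · simp
  rw [Finset.sum_congr rfl fun a _ => e1 a]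
  rw [← Finset.smul_sum, Finset.sum_sub_distrib, Finset.sum_add_distrib, ← Finset.smul_sum,
    ← Finset.smul_sum, ← Finset.smul_sum, symProj_contract' hE S, symProj_contract' hE S,
    Finset.sum_comm, ← sum_sn (f := fun u => sP E (l + 1) i u • HP E (l + 1) u), symProj_self hE S,
    HP_succ]
  have e2 : (l : ℂ) + 2 = (l + 1 : ℕ) + 1 := by push_cast; ring
  have e3 : (l : ℂ) + 1 = (l + 1 : ℕ) := by push_cast; ring
  have hn0 : ((l + 1 : ℕ) : ℂ) ≠ 0 := by exact_mod_cast Nat.succ_ne_zero l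
  have hβ : (E : ℂ) + 2 * (l + 1 : ℕ) - 2 ≠ 0 := by
    have : (E : ℂ) + 2 * (l + 1 : ℕ) - 2 = ((E + 2 * l : ℕ) : ℂ) := by push_cast; ring
    rw [this]
    exact_mod_cast (by omega : E + 2 * l ≠ 0)
  rw [e2, e3, pderiv_comm h k]
  congr 1
  set φ := HP E (l + 1) i with hφ
  have e4 : (((E : ℂ) + 2 * l - 2)⁻¹ - 2 * ((E : ℂ) + 2 * (l + 1 : ℕ) - 2)⁻¹ * ((E : ℂ) + 2 * l - 2)⁻¹
      - ((E : ℂ) + 2 * (l + 1 : ℕ) - 2)⁻¹) • pderiv k (pderiv h φ) = 0 := by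
    by_cases hα : (E : ℂ) + 2 * l - 2 = 0
    · have hl : l = 0 := by
        have : (E : ℂ) + 2 * l = 2 := by linear_combination hα
        have : E + 2 * l = 2 := by exact_mod_cast this
        omega
      subst hl
      have h1 := (mem_HS.1 (HS_pderiv (HP_mem hE 1 i) h)).1
      rw [← totalDegree_zero_iff_isHomogeneous, totalDegree_eq_zero_iff_eq_C] at h1
      rw [hφ, h1, pderiv_C, smul_zero]
    · rw [show ((E : ℂ) + 2 * l - 2)⁻¹ - 2 * ((E : ℂ) + 2 * (l + 1 : ℕ) - 2)⁻¹ * ((E : ℂ) + 2 * l - 2)⁻¹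
      - ((E : ℂ) + 2 * (l + 1 : ℕ) - 2)⁻¹ = 0 from ?_, zero_smul]
      push_cast at hβ ⊢
      field_simp
      ring
  have e5 : pderiv k (X h * φ - ((E : ℂ) + 2 * (l + 1 : ℕ) - 2)⁻¹ • (r2 E * pderiv h φ)) =
      (if h = k then (1 : ℂ) else 0) • φ + X h * pderiv k φ -
      ((E : ℂ) + 2 * (l + 1 : ℕ) - 2)⁻¹ • (2 * X k * pderiv h φ + r2 E * pderiv k (pderiv h φ)) := by
    rw [map_sub, Derivation.map_smul, pderiv_mul, pderiv_mul, pderiv_r2, pderiv_X]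
    congr 2
    by_cases hk : h = k <;> simp [hk]
  rw [e5, smul_smul, smul_smul, mul_inv_cancel₀ hn0, one_smul,
    show 2 * ((l + 1 : ℕ) : ℂ) * ((E : ℂ) + 2 * (l + 1 : ℕ) - 2)⁻¹ * ((l + 1 : ℕ) : ℂ)⁻¹ = 2 * ((E : ℂ) + 2 * (l + 1 : ℕ) - 2)⁻¹ by
      field_simp]
  rw [smul_eq_C_mul] at e4
  simp only [smul_eq_C_mul, C_sub, C_mul, C2] at e4 ⊢
  linear_combination (-r2 E) * e4

lemma sP_eq {E : ℕ} (hE : 2 ≤ E) (l : ℕ) (i j : Fin l → Fin E) :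
    sP E l i j = (l.factorial : ℂ)⁻¹ * TT E l j (HP E l i) := by
  induction l with
  | zero =>
    have : i = j := Subsingleton.elim _ _
    simp [sP, symProj, TT, HP, this, Matrix.one_apply]
  | succ l ih =>
    cases l with
    | zero =>
      simp only [sP, symProj, Matrix.one_apply, TT, HP]
      have : i = j ↔ i 0 = j 0 := by
        constructor
        · rintro rfl; rfl
        · intro h; funext m; rw [Fin.fin_one_eq_zero m]; exact h
      by_cases h : i 0 = j 0 <;> simp [this, h, pderiv_X]
    | succ l =>
      rw [sP_entry]
      have h1 := symProj_key hE ih (fun m => i m.castSucc) (i (Fin.last _)) (j (Fin.last _))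
      rw [sn_init] at h1
      rw [TT_succ]
      have h2 : pderiv (j (Fin.last (l + 1))) (HP E (l + 2) i) = ((l : ℂ) + 2) •
        ∑ a : Fin l → Fin E, ∑ b : Fin E, ∑ c : Fin E,
          (sP E (l + 1) (fun m => i m.castSucc) (sn a b) *
            MStep E (l + 1) (b, i (Fin.last _)) (c, j (Fin.last _))) • HP E (l + 1) (sn a c) := by
        rw [h1, smul_smul, mul_inv_cancel₀, one_smul]
        exact_mod_cast Nat.succ_ne_zero (l + 1)
      rw [h2]
      simp only [map_smul, map_sum, smul_eq_mul, Finset.mul_sum]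
      refine Finset.sum_congr rfl fun a _ => Finset.sum_congr rfl fun b _ =>
        Finset.sum_congr rfl fun c _ => ?_
      rw [ih (sn a c)]
      have h3 : ((l : ℂ) + 2) ≠ 0 := by exact_mod_cast Nat.succ_ne_zero (l + 1)
      have h4 : ((l + 1).factorial : ℂ) ≠ 0 := by exact_mod_cast (l + 1).factorial_ne_zero
      rw [Nat.factorial_succ (l + 1)]
      push_cast
      rw [show (l : ℂ) + 1 + 1 = l + 2 by ring]
      field_simp

lemma symProj_eq {E : ℕ} (hE : 2 ≤ E) (l : ℕ) (i j : Fin l → Fin E) :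
    symProj E l i j = (l.factorial : ℂ)⁻¹ * TT E l j (HP E l i) := sP_eq hE l i j

lemma harmX_eq {E : ℕ} (hE : 2 ≤ E) (l : ℕ) (i : Fin l → Fin E) : harmX E l i = HP E l i := by
  rw [harmX]
  simp_rw [symProj_eq hE, mul_smul]
  rw [← Finset.smul_sum, taylor (mem_HS.1 (HP_mem hE l i)).1, smul_smul, inv_mul_cancel₀, one_smul]
  exact_mod_cast l.factorial_ne_zero

lemma harmX_mem {E : ℕ} (hE : 2 ≤ E) (l : ℕ) (i : Fin l → Fin E) : harmX E l i ∈ HS E l := by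
  rw [harmX_eq hE]; exact HP_mem hE l i

lemma harmX_congr {E : ℕ} (hE : 2 ≤ E) (l : ℕ) (i : Fin l → Fin E) :
    r2 E ∣ harmX E l i - ∏ m, X (i m) := by
  rw [harmX_eq hE]; exact HP_congr l i

lemma harmX_contract {D m : ℕ} (hD : 2 ≤ D) (i : Fin (m + 1) → Fin D) (h : Fin D) :
    ∑ j : Fin m → Fin D, symProj D (m + 1) i (Fin.cons h j) • harmX D m j =
      ((m : ℂ) + 1)⁻¹ • pderiv h (harmX D (m + 1) i) := by
  simp_rw [harmX_eq hD]
  rw [← symProj_contract hD (sP_eq hD (m + 1))]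
  refine Finset.sum_congr rfl fun a _ => ?_
  rw [symProj_eq hD, sP_eq hD, TT_cons, TT_succ]
  simp

lemma harmX_cons {D l : ℕ} (hD : 2 ≤ D) (i : Fin l → Fin D) (h : Fin D) :
    harmX D (l + 1) (Fin.cons h i) = X h * harmX D l i -
      ((D : ℂ) + 2 * l - 2)⁻¹ • (r2 D * pderiv h (harmX D l i)) := by
  refine HS_unique (by omega) (harmX_mem hD _ _) (HS_step hD (harmX_mem hD _ _) h) ?_
  obtain ⟨q, hq⟩ := harmX_congr hD (l + 1) (Fin.cons h i)
  obtain ⟨q', hq'⟩ := harmX_congr hD l i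
  rw [Fin.prod_univ_succ] at hq
  simp only [Fin.cons_zero, Fin.cons_succ] at hq
  refine ⟨q - X h * q' + ((D : ℂ) + 2 * l - 2)⁻¹ • pderiv h (harmX D l i), ?_⟩
  simp only [smul_eq_C_mul]
  linear_combination hq - X h * hq'


/-! ### From `D` to `D + 1` variables -/

/-- Embedding of polynomials in `D` variables. -/
abbrev up (D : ℕ) : Poly D →ₐ[ℂ] Poly (D + 1) := rename Fin.castSucc

lemma pderiv_last_up {D : ℕ} (φ : Poly D) : pderiv (Fin.last D) (up D φ) = 0 := by
  classical
  apply pderiv_eq_zero_of_notMem_vars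
  intro h
  have := vars_rename _ _ h
  simp only [Finset.mem_image] at this
  obtain ⟨a, -, ha⟩ := this
  exact absurd ha (Fin.castSucc_lt_last a).ne

lemma pderiv_cs_up {D : ℕ} (i : Fin D) (φ : Poly D) :
    pderiv i.castSucc (up D φ) = up D (pderiv i φ) :=
  pderiv_rename (Fin.castSucc_injective D) _ _

lemma lap_up {D : ℕ} (φ : Poly D) : lap (up D φ) = up D (lap φ) := by
  simp only [lap, Fin.sum_univ_castSucc, pderiv_last_up, pderiv_cs_up, map_zero, add_zero, map_sum]

lemma up_mem {D l : ℕ} {φ : Poly D} (h : φ ∈ HS D l) : up D φ ∈ HS (D + 1) l := by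
  obtain ⟨h1, h2⟩ := mem_HS.1 h
  exact mem_HS.2 ⟨h1.rename_isHomogeneous, by rw [lap_up, h2, map_zero]⟩

lemma r2_up (D : ℕ) : up D (r2 D) = r2 (D + 1) - X (Fin.last D) * X (Fin.last D) := by
  simp [r2, Fin.sum_univ_castSucc]

lemma Fcheck_mem {D : ℕ} (hD : 2 ≤ D) (Λ l : ℕ) (i : Fin l → Fin D) :
    Fcheck D Λ l i ∈ HS (D + 1) Λ :=
  Submodule.sum_mem _ fun _ _ => Submodule.smul_mem _ _ (harmX_mem (by omega) _ _)

lemma prod_extIdx {D l Λ : ℕ} (hl : l ≤ Λ) (j : Fin l → Fin D) :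
    ∏ m, (X (extIdx D l Λ j m) : Poly (D + 1)) =
      X (Fin.last D) ^ (Λ - l) * up D (∏ m, X (j m)) := by
  obtain ⟨n, rfl⟩ := Nat.exists_eq_add_of_le hl
  rw [Fin.prod_univ_add, Nat.add_sub_cancel_left]
  simp [extIdx, mul_comm]

lemma Fcheck_congr {D : ℕ} (hD : 2 ≤ D) {Λ l : ℕ} (hl : l ≤ Λ) (i : Fin l → Fin D) :
    r2 (D + 1) ∣ Fcheck D Λ l i - X (Fin.last D) ^ (Λ - l) * up D (harmX D l i) := by
  have : (X (Fin.last D) ^ (Λ - l) * up D (harmX D l i) : Poly (D + 1)) =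
      ∑ j : Fin l → Fin D, symProj D l i j • ∏ m, X (extIdx D l Λ j m) := by
    rw [harmX, map_sum, Finset.mul_sum]
    refine Finset.sum_congr rfl fun j _ => ?_
    rw [prod_extIdx hl, map_smul, mul_smul_comm]
  rw [this, Fcheck, ← Finset.sum_sub_distrib]
  refine Finset.dvd_sum fun a _ => ?_
  rw [← smul_sub, smul_eq_C_mul]
  exact Dvd.dvd.mul_left (harmX_congr (by omega) _ _) _

/-! ### The coefficients `b` -/

lemma bcoef_eq (D Λ l k : ℕ) :
    bcoef D Λ l k = ((-1 : ℂ)) ^ k * ((Λ - l).factorial : ℂ) *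
      ((2 * Λ + D - 3 - 2 * k).doubleFactorial : ℂ) /
    (((Λ - l - 2 * k).factorial : ℂ) * ((2 * k).doubleFactorial : ℂ) *
      ((2 * Λ + D - 3).doubleFactorial : ℂ)) := by
  rw [bcoef]
  split_ifs with h
  · subst h
    have h1 : ((Λ - l).factorial : ℂ) ≠ 0 := by exact_mod_cast Nat.factorial_ne_zero _
    have h2 : ((2 * Λ + D - 3).doubleFactorial : ℂ) ≠ 0 := by
      exact_mod_cast (Nat.doubleFactorial_pos _).ne'
    simp only [mul_zero, Nat.sub_zero, pow_zero, Nat.doubleFactorial, Nat.cast_one, mul_one,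
      one_mul]
    rw [div_self (mul_ne_zero h1 h2)]
  · rfl

lemma bcoef_rec {D : ℕ} (hD : 2 ≤ D) {Λ l m : ℕ} (r : ℕ) (hr : Λ = l + (2 * (m + 1) + r)) :
    bcoef D Λ l m * ((r + 2) * (r + 1)) +
      bcoef D Λ l (m + 1) * (2 * (m + 1) * (2 * m + (D + 1) + 2 * (r + l))) = 0 := by
  obtain ⟨d, rfl⟩ := Nat.exists_eq_add_of_le hD
  subst hr
  rw [bcoef_eq, bcoef_eq]
  have e1 : l + (2 * (m + 1) + r) - l = 2 * (m + 1) + r := by omega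
  have e2 : 2 * (l + (2 * (m + 1) + r)) + (2 + d) - 3 - 2 * m = (2 * l + 2 * m + 2 * r + d + 1) + 2 := by
    omega
  have e3 : 2 * (l + (2 * (m + 1) + r)) + (2 + d) - 3 - 2 * (m + 1) = 2 * l + 2 * m + 2 * r + d + 1 := by
    omega
  have e4 : 2 * (m + 1) + r - 2 * m = r + 2 := by omega
  have e5 : 2 * (m + 1) + r - 2 * (m + 1) = r := by omega
  rw [e1, e2, e3, e4, e5, show 2 * (m + 1) = 2 * m + 2 by ring, Nat.doubleFactorial_add_two,
    Nat.doubleFactorial_add_two, Nat.factorial_succ, Nat.factorial_succ r]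
  have n1 : ((2 * (l + (2 * m + 2 + r)) + (2 + d) - 3).doubleFactorial : ℂ) ≠ 0 := by
    exact_mod_cast (Nat.doubleFactorial_pos _).ne'
  have n2 : ((2 * m).doubleFactorial : ℂ) ≠ 0 := by
    exact_mod_cast (Nat.doubleFactorial_pos _).ne'
  have n3 : (r.factorial : ℂ) ≠ 0 := by exact_mod_cast Nat.factorial_ne_zero _
  have n4 : (r : ℂ) + 1 ≠ 0 := by exact_mod_cast Nat.succ_ne_zero r
  have n5 : (r : ℂ) + 1 + 1 ≠ 0 := by exact_mod_cast Nat.succ_ne_zero (r + 1)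
  have n6 : 2 * (m : ℂ) + 2 ≠ 0 := by exact_mod_cast Nat.succ_ne_zero (2 * m + 1)
  push_cast
  generalize ((2 * (l + (2 * m + 2 + r)) + (2 + d) - 3).doubleFactorial : ℂ) = A at *
  generalize ((2 * l + 2 * m + 2 * r + d + 1).doubleFactorial : ℂ) = B at *
  generalize ((2 * m).doubleFactorial : ℂ) = F at *
  generalize ((r).factorial : ℂ) = G at *
  generalize ((2 * m + 2 + r).factorial : ℂ) = H at *
  rw [pow_succ]
  field_simp
  ring

/-! ### Part (a) -/

lemma lap_xpow {D : ℕ} {ψ : Poly (D + 1)} (h1 : pderiv (Fin.last D) ψ = 0) (h2 : lap ψ = 0)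
    (a : ℕ) : lap (X (Fin.last D) ^ (a + 2) * ψ) =
      ((a : Poly (D + 1)) + 2) * ((a : Poly (D + 1)) + 1) * (X (Fin.last D) ^ a * ψ) := by
  have hp : ∀ a : ℕ, pderiv (Fin.last D) (X (Fin.last D) ^ (a + 1) * ψ) =
      ((a : Poly (D + 1)) + 1) * (X (Fin.last D) ^ a * ψ) := by
    intro a
    rw [pderiv_mul, h1, pderiv_pow, pderiv_X_self]
    push_cast
    simp; ring
  induction a with
  | zero =>
    rw [pow_succ', mul_assoc, lap_X_mul, hp, pow_one, lap_X_mul, h1, h2]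
    push_cast; ring
  | succ a ih =>
    rw [pow_succ', mul_assoc, lap_X_mul, hp, ih]
    push_cast; ring

lemma lap_xpow1 {D : ℕ} {ψ : Poly (D + 1)} (h1 : pderiv (Fin.last D) ψ = 0) (h2 : lap ψ = 0)
    (a : ℕ) (ha : a < 2) : lap (X (Fin.last D) ^ a * ψ) = 0 := by
  interval_cases a
  · simpa using h2
  · rw [pow_one, lap_X_mul, h1, h2]; simp

lemma pCheck_mem {D : ℕ} (hD : 2 ≤ D) {Λ l : ℕ} (hl : l ≤ Λ) {Y : Poly (D + 1)}
    (hY : Y ∈ HS (D + 1) l) (h1 : pderiv (Fin.last D) Y = 0) :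
    pCheck D Λ l * Y ∈ HS (D + 1) Λ := by
  obtain ⟨hh, h2⟩ := mem_HS.1 hY
  obtain ⟨n, rfl⟩ := Nat.exists_eq_add_of_le hl
  have hterm : ∀ k ∈ Finset.range (n / 2 + 1),
      ((X (Fin.last D) : Poly (D + 1)) ^ (n - 2 * k) * (r2 (D + 1)) ^ k * Y).IsHomogeneous (l + n) := by
    intro k hk
    rw [Finset.mem_range] at hk
    have := (((isHomogeneous_X ℂ (Fin.last D)).pow (n - 2 * k)).mul ((r2_hom (D + 1)).pow k)).mul hh
    rwa [show 1 * (n - 2 * k) + 2 * k + l = l + n by omega] at this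
  have hp : pCheck D (l + n) l * Y = ∑ k ∈ Finset.range (n / 2 + 1),
      bcoef D (l + n) l k • (X (Fin.last D) ^ (n - 2 * k) * (r2 (D + 1)) ^ k * Y) := by
    rw [pCheck, Nat.add_sub_cancel_left, Finset.sum_mul]
    exact Finset.sum_congr rfl fun k _ => by rw [smul_mul_assoc]
  rw [hp]
  refine mem_HS.2 ⟨IsHomogeneous.sum _ _ _ fun k hk => ?_, ?_⟩
  · rw [smul_eq_C_mul]; exact (hterm k hk).C_mul _
  have part : ∀ m ≤ n / 2, ∑ k ∈ Finset.range (m + 1),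
      lap (bcoef D (l + n) l k • (X (Fin.last D) ^ (n - 2 * k) * (r2 (D + 1)) ^ k * Y)) =
      bcoef D (l + n) l m • (r2 (D + 1) ^ m * lap (X (Fin.last D) ^ (n - 2 * m) * Y)) := by
    intro m hm
    induction m with
    | zero => simp [lap_smul]
    | succ m ih =>
      rw [Finset.sum_range_succ, ih (by omega), lap_smul,
        show X (Fin.last D) ^ (n - 2 * (m + 1)) * r2 (D + 1) ^ (m + 1) * Y =
          r2 (D + 1) ^ (m + 1) * (X (Fin.last D) ^ (n - 2 * (m + 1)) * Y) by ring,
        lap_r2_pow_mul (((isHomogeneous_X ℂ (Fin.last D)).pow (n - 2 * (m + 1))).mul hh)]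
      obtain ⟨r, hr⟩ : ∃ r, n = 2 * (m + 1) + r := ⟨n - 2 * (m + 1), by omega⟩
      have hb := bcoef_rec hD r (congrArg (l + ·) hr)
      rw [show n - 2 * m = r + 2 by omega, show n - 2 * (m + 1) = r by omega, lap_xpow h1 h2]
      have hb' := congrArg (C : ℂ → Poly (D + 1)) hb
      simp only [C_add, C_mul, C2, C_1, C_0, map_natCast] at hb'
      simp only [smul_eq_C_mul]
      push_cast
      linear_combination (r2 (D + 1) ^ m * (X (Fin.last D) ^ r * Y)) * hb'
  have := part (n / 2) le_rfl
  rw [lap_xpow1 h1 h2 _ (by omega), mul_zero, smul_zero] at this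
  rw [← lapL_apply, map_sum]
  rw [← this]
  exact Finset.sum_congr rfl fun k _ => lapL_apply _

lemma pCheck_congr {D : ℕ} (Λ l : ℕ) (Y : Poly (D + 1)) :
    r2 (D + 1) ∣ pCheck D Λ l * Y - X (Fin.last D) ^ (Λ - l) * Y := by
  rw [pCheck, Finset.sum_range_succ', ← sub_mul]
  refine Dvd.dvd.mul_right ?_ _
  have : bcoef D Λ l 0 = 1 := by simp [bcoef]
  rw [this]
  simp only [mul_zero, Nat.sub_zero, pow_zero, mul_one, one_smul, add_sub_cancel_right]
  refine Finset.dvd_sum fun k _ => ?_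
  rw [smul_eq_C_mul, pow_succ]
  exact Dvd.dvd.mul_left (Dvd.dvd.mul_left (Dvd.dvd.mul_left dvd_rfl _) _) _

lemma part_a {D Λ : ℕ} (hD : 2 ≤ D) (l : ℕ) (hl : l ≤ Λ) (i : Fin l → Fin D) :
    Fcheck D Λ l i = pCheck D Λ l * up D (harmX D l i) := by
  refine HS_unique (by omega) (Fcheck_mem hD Λ l i)
    (pCheck_mem hD hl (up_mem (harmX_mem hD l i)) (pderiv_last_up _)) ?_
  have := dvd_sub (Fcheck_congr hD hl i) (pCheck_congr Λ l (up D (harmX D l i)))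
  simpa using this

/-! ### Rotations -/

/-- The rotation vector field `x^j ∂_i − x^i ∂_j`. -/
def Rd {E : ℕ} (i j : Fin E) : Derivation ℂ (Poly E) (Poly E) :=
  (X j : Poly E) • pderiv i - (X i : Poly E) • pderiv j

lemma Rd_apply {E : ℕ} (i j : Fin E) (φ : Poly E) :
    Rd i j φ = X j * pderiv i φ - X i * pderiv j φ := rfl

lemma Rd_r2 {E : ℕ} (i j : Fin E) : Rd i j (r2 E) = 0 := by
  rw [Rd_apply, pderiv_r2, pderiv_r2]; ring

lemma Rd_mul {E : ℕ} (i j : Fin E) (φ ψ : Poly E) :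
    Rd i j (φ * ψ) = φ * Rd i j ψ + Rd i j φ * ψ := by
  rw [Derivation.leibniz, smul_eq_mul, smul_eq_mul, mul_comm ψ]

lemma Rd_mem {E d : ℕ} (i j : Fin E) {φ : Poly E} (h : φ ∈ HS E d) : Rd i j φ ∈ HS E d := by
  cases d with
  | zero =>
    have h1 := (mem_HS.1 h).1
    rw [← totalDegree_zero_iff_isHomogeneous, totalDegree_eq_zero_iff_eq_C] at h1
    rw [h1, Rd_apply, pderiv_C, pderiv_C]
    simp
  | succ d =>
    obtain ⟨hi, hi'⟩ := mem_HS.1 (HS_pderiv h i)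
    obtain ⟨hj, hj'⟩ := mem_HS.1 (HS_pderiv h j)
    refine mem_HS.2 ⟨?_, ?_⟩
    · rw [Rd_apply, add_comm]
      exact ((isHomogeneous_X ℂ j).mul hi).sub ((isHomogeneous_X ℂ i).mul hj)
    · rw [Rd_apply, lap_sub, lap_X_mul, lap_X_mul, hi', hj', pderiv_comm]; ring

lemma Rd_dvd {E : ℕ} (i j : Fin E) {φ ψ : Poly E} (h : r2 E ∣ φ - ψ) :
    r2 E ∣ Rd i j φ - Rd i j ψ := by
  obtain ⟨q, hq⟩ := h
  refine ⟨Rd i j q, ?_⟩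
  rw [← map_sub, hq, Rd_mul, Rd_r2]; ring

lemma ang_eq {E : ℕ} (i j : Fin E) (φ : Poly E) : ang i j φ = Complex.I • Rd i j φ := rfl

lemma ang_ang {E : ℕ} (i j : Fin E) (φ : Poly E) : ang i j (ang i j φ) = - Rd i j (Rd i j φ) := by
  rw [ang_eq, ang_eq, Derivation.map_smul, smul_smul, Complex.I_mul_I, neg_smul, one_smul]

lemma I_ang {E : ℕ} (i j : Fin E) (φ : Poly E) : Complex.I • ang i j φ = Rd j i φ := by
  rw [ang_eq, smul_smul, Complex.I_mul_I, Rd_apply, Rd_apply]; simp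

/-! ### Part (b) -/

lemma Rd_sq_sum {E l : ℕ} {φ : Poly E} (h : φ ∈ HS E l) :
    ∑ i, ∑ j, Rd i j (Rd i j φ) = -(2 * l * (l + E - 2) : Poly E) * φ := by
  obtain ⟨h1, h2⟩ := mem_HS.1 h
  have hη := euler h1
  have e : ∀ i j : Fin E, Rd i j (Rd i j φ) =
      ((if i = j then X j * pderiv i φ else 0) + (if i = j then X i * pderiv j φ else 0)) +
      ((X j * X j) * pderiv i (pderiv i φ) + (X i * X i) * pderiv j (pderiv j φ)) -
      (X j * pderiv j φ + X i * pderiv i φ) - 2 * (X i * (X j * pderiv j (pderiv i φ))) := by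
    intro i j
    simp only [Rd_apply, map_sub, pderiv_mul, pderiv_X_self]
    rw [pderiv_comm i j φ]
    by_cases hij : i = j
    · subst hij; simp; ring
    · rw [pderiv_X_of_ne hij, pderiv_X_of_ne (Ne.symm hij), if_neg hij, if_neg hij]; ring
  have e2 : ∀ i : Fin E, ∑ j, X j * pderiv j (pderiv i φ) = (l : Poly E) * pderiv i φ - pderiv i φ := by
    intro i
    have := congrArg (pderiv i) hη
    rw [map_sum] at this
    simp only [pderiv_mul, pderiv_X, Finset.sum_add_distrib] at this
    simp only [Pi.single_apply, ite_mul, one_mul, zero_mul, Finset.sum_ite_eq', Finset.sum_ite_eq,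
      Finset.mem_univ, if_true] at this
    have hc : pderiv i (l : Poly E) = 0 := by
      rw [← map_natCast (C : ℂ →+* Poly E), pderiv_C]
    rw [hc, zero_mul, zero_add] at this
    rw [← this, add_sub_cancel_left]
    exact Finset.sum_congr rfl fun j _ => by rw [pderiv_comm]
  simp_rw [e]
  simp only [Finset.sum_sub_distrib, Finset.sum_add_distrib, ← Finset.mul_sum, ← Finset.sum_mul,
    Finset.sum_ite_eq, Finset.mem_univ, if_true, e2, mul_sub, hη]
  simp only [Finset.sum_const, Finset.card_univ, Fintype.card_fin, nsmul_eq_mul]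
  have e3 : ∑ i, X i * ((l : Poly E) * pderiv i φ) = l * (l * φ) := by
    rw [← hη, Finset.mul_sum]
    exact Finset.sum_congr rfl fun j _ => by ring
  have e4 : ∑ i, pderiv i (pderiv i φ) = 0 := h2
  have e5 : ∑ i, X i * ((E : Poly E) * pderiv i φ) = E * (l * φ) := by
    rw [← hη, Finset.mul_sum]
    exact Finset.sum_congr rfl fun j _ => by ring
  simp only [e4, e3]
  rw [e5]
  ring

lemma Rd_up {D : ℕ} (i j : Fin D) (φ : Poly D) :
    Rd i.castSucc j.castSucc (up D φ) = up D (Rd i j φ) := by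
  simp [Rd_apply, pderiv_cs_up]

lemma Rd_pCheck {D : ℕ} (Λ l : ℕ) (i j : Fin D) :
    Rd i.castSucc j.castSucc (pCheck D Λ l) = 0 := by
  have hx : Rd i.castSucc j.castSucc (X (Fin.last D) : Poly (D + 1)) = 0 := by
    rw [Rd_apply, pderiv_X_of_ne (Fin.castSucc_lt_last i).ne',
      pderiv_X_of_ne (Fin.castSucc_lt_last j).ne']
    simp
  rw [pCheck, map_sum]
  refine Finset.sum_eq_zero fun k _ => ?_
  rw [Derivation.map_smul, Rd_mul, Derivation.leibniz_pow, Derivation.leibniz_pow, hx, Rd_r2]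
  simp

lemma part_b {D Λ : ℕ} (hD : 2 ≤ D) (l : ℕ) (hl : l ≤ Λ) (i : Fin l → Fin D) :
    lsqLow D (Fcheck D Λ l i) = ((l * (l + D - 2) : ℕ) : ℂ) • Fcheck D Λ l i := by
  rw [part_a hD l hl i]
  have : ∀ (a b : Fin D), ang a.castSucc b.castSucc (ang a.castSucc b.castSucc
      (pCheck D Λ l * up D (harmX D l i))) =
      - (pCheck D Λ l * up D (Rd a b (Rd a b (harmX D l i)))) := by
    intro a b
    rw [ang_ang, Rd_mul, Rd_pCheck, zero_mul, add_zero, Rd_mul, Rd_pCheck, zero_mul, add_zero,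
      Rd_up, Rd_up]
  simp only [lsqLow, this, Finset.sum_neg_distrib, ← Finset.mul_sum, ← map_sum]
  rw [Rd_sq_sum (harmX_mem hD l i)]
  have hc : ((l * (l + D - 2) : ℕ) : ℂ) = l * (l + D - 2) := by
    rw [Nat.cast_mul, Nat.cast_sub (by omega)]; push_cast; ring
  have hC : (2 * l * (l + D - 2) : Poly D) = C (2 * (l * (l + D - 2) : ℂ)) := by
    simp [C2]; ring
  rw [hc, hC, neg_mul, map_neg, ← smul_eq_C_mul, map_smul, mul_neg, neg_neg, mul_smul_comm,
    smul_smul]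
  congr 1
  ring

/-! ### Part (c) -/

lemma part_c_congr {D Λ : ℕ} (hD : 2 ≤ D) (l : ℕ) (hl : l ≤ Λ) (h : Fin D) (i : Fin l → Fin D) :
    r2 (D + 1) ∣ Rd (Fin.last D) h.castSucc (Fcheck D Λ l i) -
      (((Λ : ℂ) - l) • Fcheck D Λ (l + 1) (Fin.cons h i) -
        (((Λ : ℂ) - l) * ((D : ℂ) + 2 * l - 2)⁻¹ + 1) •
          (X (Fin.last D) ^ (Λ - l + 1) * up D (pderiv h (harmX D l i)))) := by
  have h1 := Rd_dvd (Fin.last D) h.castSucc (Fcheck_congr hD hl i)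
  set Y := harmX D l i with hY
  have hcons := congrArg (up D) (harmX_cons hD i h)
  rw [map_sub, map_mul, map_smul, map_mul, r2_up, ← hY] at hcons
  have hX : up D (X h) = X h.castSucc := rename_X _ _
  rw [hX] at hcons
  have e1 : Rd (Fin.last D) h.castSucc (X (Fin.last D) : Poly (D + 1)) = X h.castSucc := by
    rw [Rd_apply, pderiv_X_self, pderiv_X_of_ne (Fin.castSucc_lt_last h).ne']; ring
  have e2 : Rd (Fin.last D) h.castSucc (up D Y) = - (X (Fin.last D) * up D (pderiv h Y)) := by
    rw [Rd_apply, pderiv_last_up, pderiv_cs_up]; ring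
  rw [Rd_mul, e2, Derivation.leibniz_pow, e1] at h1
  obtain ⟨q, hq⟩ := h1
  obtain ⟨n, rfl⟩ := Nat.exists_eq_add_of_le hl
  have hc : ((l + n : ℕ) : ℂ) - l = n := by push_cast; ring
  rw [hc]
  rw [Nat.add_sub_cancel_left] at hq ⊢
  cases n with
  | zero =>
    refine ⟨q, ?_⟩
    rw [← hq]
    simp
  | succ n =>
    obtain ⟨q', hq'⟩ := Fcheck_congr hD (show l + 1 ≤ l + (n + 1) by omega) (Fin.cons h i)
    rw [show l + (n + 1) - (l + 1) = n by omega] at hq'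
    simp only [smul_eq_C_mul, C_mul, C_add, C_1, map_natCast, Nat.add_sub_cancel, nsmul_eq_mul,
      smul_eq_mul] at *
    refine ⟨q - ((n + 1 : ℕ) : Poly (D + 1)) * q' + ((n + 1 : ℕ) : Poly (D + 1)) *
      X (Fin.last D) ^ n * C (((D : ℂ) + 2 * l - 2)⁻¹) * up D (pderiv h Y), ?_⟩
    linear_combination hq - ((n + 1 : ℕ) : Poly (D + 1)) * hq' -
      ((n + 1 : ℕ) : Poly (D + 1)) * X (Fin.last D) ^ n * hcons

lemma part_c0 {D Λ : ℕ} (hD : 2 ≤ D) (h : Fin D) (i : Fin 0 → Fin D) :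
    Complex.I • ang (Fin.castSucc h) (Fin.last D) (Fcheck D Λ 0 i) =
        (Λ : ℂ) • Fcheck D Λ 1 (Fin.cons h i) := by
  rw [I_ang]
  refine HS_unique (by omega) (Rd_mem _ _ (Fcheck_mem hD _ _ _))
    (Submodule.smul_mem _ _ (Fcheck_mem hD _ _ _)) ?_
  have := part_c_congr hD 0 (Nat.zero_le Λ) h i
  have h0 : pderiv h (harmX D 0 i) = 0 := by
    rw [harmX_eq hD]; simp [HP]
  rw [h0] at this
  simpa using this

lemma part_c {D Λ : ℕ} (hD : 2 ≤ D) (m : ℕ) (hm : m + 1 ≤ Λ) (h : Fin D)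
    (i : Fin (m + 1) → Fin D) :
    Complex.I • ang (Fin.castSucc h) (Fin.last D) (Fcheck D Λ (m + 1) i) =
        ((Λ : ℂ) - ((m : ℂ) + 1)) • Fcheck D Λ (m + 2) (Fin.cons h i) -
          (((m : ℂ) + 1) * ((Λ : ℂ) + ((m : ℂ) + 1) + (D : ℂ) - 2) /
              ((D : ℂ) + 2 * ((m : ℂ) + 1) - 2)) •
            ∑ j : Fin m → Fin D, symProj D (m + 1) i (Fin.cons h j) • Fcheck D Λ m j := by
  rw [I_ang]
  refine HS_unique (by omega) (Rd_mem _ _ (Fcheck_mem hD _ _ _))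
    (Submodule.sub_mem _ (Submodule.smul_mem _ _ (Fcheck_mem hD _ _ _))
      (Submodule.smul_mem _ _ (Submodule.sum_mem _ fun j _ =>
        Submodule.smul_mem _ _ (Fcheck_mem hD _ _ _)))) ?_
  have h1 := part_c_congr hD (m + 1) hm h i
  have h2 : r2 (D + 1) ∣ ∑ j : Fin m → Fin D, symProj D (m + 1) i (Fin.cons h j) • Fcheck D Λ m j -
      ((m : ℂ) + 1)⁻¹ • (X (Fin.last D) ^ (Λ - m) * up D (pderiv h (harmX D (m + 1) i))) := by
    rw [← mul_smul_comm, ← map_smul, ← harmX_contract hD, map_sum, Finset.mul_sum,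
      ← Finset.sum_sub_distrib]
    refine Finset.dvd_sum fun j _ => ?_
    rw [map_smul, mul_smul_comm, ← smul_sub, smul_eq_C_mul]
    exact Dvd.dvd.mul_left (Fcheck_congr hD (by omega) _) _
  rw [show Λ - (m + 1) + 1 = Λ - m by omega] at h1
  set S := ∑ j : Fin m → Fin D, symProj D (m + 1) i (Fin.cons h j) • Fcheck D Λ m j with hS
  have hm0 : (m : ℂ) + 1 ≠ 0 := by exact_mod_cast Nat.succ_ne_zero m
  have hβ : (D : ℂ) + 2 * ((m : ℂ) + 1) - 2 ≠ 0 := by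
    have : (D : ℂ) + 2 * ((m : ℂ) + 1) - 2 = ((D + 2 * m : ℕ) : ℂ) := by push_cast; ring
    rw [this]
    exact_mod_cast (by omega : D + 2 * m ≠ 0)
  set c := ((m : ℂ) + 1) * ((Λ : ℂ) + ((m : ℂ) + 1) + (D : ℂ) - 2) /
              ((D : ℂ) + 2 * ((m : ℂ) + 1) - 2) with hc
  have hcc : ((Λ : ℂ) - (m + 1 : ℕ)) * ((D : ℂ) + 2 * (m + 1 : ℕ) - 2)⁻¹ + 1 =
      c * ((m : ℂ) + 1)⁻¹ := by
    obtain ⟨B, hB⟩ : ∃ B : ℂ, B = (D : ℂ) + 2 * ((m : ℂ) + 1) - 2 := ⟨_, rfl⟩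
    rw [hc]; push_cast
    rw [← hB] at hβ ⊢
    rw [show (Λ : ℂ) + ((m : ℂ) + 1) + D - 2 = Λ - ((m : ℂ) + 1) + B by rw [hB]; ring]
    field_simp
  rw [hcc] at h1
  have h3 := dvd_add h1 (Dvd.dvd.mul_left h2 (C c))
  convert h3 using 1
  simp only [smul_eq_C_mul, C_mul]
  push_cast
  ring


/-- (a) `F̌^{i_1…i_l}_{𝐃,Λ} = p̌_{Λ,l}·X_l^{i_1…i_l}`;
(b) `L² F̌ = l(l+D−2)·F̌`; (c) the action of `iL_{h𝐃}` on the `F̌`'s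
(the case `l = 0`, where the second term is absent, is stated separately). -/
theorem statement12 (D Λ : ℕ) (hD : 2 ≤ D) :
    (∀ l ≤ Λ, ∀ i : Fin l → Fin D,
      Fcheck D Λ l i = pCheck D Λ l * (rename Fin.castSucc (harmX D l i))) ∧
    (∀ l ≤ Λ, ∀ i : Fin l → Fin D,
      lsqLow D (Fcheck D Λ l i) = ((l * (l + D - 2) : ℕ) : ℂ) • Fcheck D Λ l i) ∧
    (∀ h : Fin D, ∀ i : Fin 0 → Fin D,
      Complex.I • ang (Fin.castSucc h) (Fin.last D) (Fcheck D Λ 0 i) =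
        (Λ : ℂ) • Fcheck D Λ 1 (Fin.cons h i)) ∧
    (∀ m : ℕ, m + 1 ≤ Λ → ∀ h : Fin D, ∀ i : Fin (m + 1) → Fin D,
      Complex.I • ang (Fin.castSucc h) (Fin.last D) (Fcheck D Λ (m + 1) i) =
        ((Λ : ℂ) - ((m : ℂ) + 1)) • Fcheck D Λ (m + 2) (Fin.cons h i) -
          (((m : ℂ) + 1) * ((Λ : ℂ) + ((m : ℂ) + 1) + (D : ℂ) - 2) /
              ((D : ℂ) + 2 * ((m : ℂ) + 1) - 2)) •
            ∑ j : Fin m → Fin D, symProj D (m + 1) i (Fin.cons h j) • Fcheck D Λ m j) := by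
  exact ⟨fun l hl i => part_a hD l hl i, fun l hl i => part_b hD l hl i,
    fun h i => part_c0 hD h i, fun m hm h i => part_c hD m hm h i⟩

end Fuzzy
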